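/- arXiv:1603.06320 — 5 statements merged into one kernel-verified Lean document; each statement's English description precedes it below -/
import Mathlib

section
/- Let 0 ≤ a < b, let m ≥ 2, and let a = x₀ < x₁ < … < x_{m−1} = b. Let r be a real polynomial of degree at most 2m−3 such that r(x_i) = η(x_i) for all 0 ≤ i ≤ m−1 and r′(x_i) = η′(x_i) for all 0 < i < m−1, where η(x) = −x·ln x. Then r(x) ≤ η(x) for all x ∈ [a, b] (Hermite interpolation of η from below, endpoint case (a) of the appendix lemma). -/
/-- `η(x) = -x·ln x` (with `η(0) = 0` since `Real.log 0 = 0`). -/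
noncomputable def eta (x : ℝ) : ℝ := -x * Real.log x

theorem aux_rolle (f f' : ℝ → ℝ)
    (S : Finset ℝ)
    (H : ∀ u ∈ S, ∀ v ∈ S, u < v → ∃ c, u < c ∧ c < v ∧ f' c = 0) (hS : S.Nonempty) :
    ∃ T : Finset ℝ, T.card + 1 = S.card ∧ Disjoint T S ∧
      ∀ t ∈ T, f' t = 0 ∧ (∃ u ∈ S, u < t) ∧ (∃ v ∈ S, t < v) := by
  induction S using Finset.induction_on_max with
  | empty => simp at hS
  | insert M S hM ih =>
    have hMS : M ∉ S := fun h => lt_irrefl _ (hM M h)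
    by_cases hS' : S.Nonempty
    · obtain ⟨T, hc, hd, hT⟩ := ih (fun u hu v hv => H u (Finset.mem_insert_of_mem hu) v
        (Finset.mem_insert_of_mem hv)) hS'
      have hmm := S.max'_mem hS'
      obtain ⟨c, h1, h2, h3⟩ := H (S.max' hS') (Finset.mem_insert_of_mem hmm) M
        (Finset.mem_insert_self _ _) (hM _ hmm)
      have hcS : ∀ s ∈ S, s < c := fun s hs => lt_of_le_of_lt (S.le_max' s hs) h1
      have hcT : c ∉ T := by
        intro h
        obtain ⟨_, _, v, hv, hlt⟩ := hT c h
        exact lt_asymm hlt (hcS v hv)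
      refine ⟨insert c T, ?_, ?_, ?_⟩
      · rw [Finset.card_insert_of_notMem hcT, Finset.card_insert_of_notMem hMS, hc]
      · rw [Finset.disjoint_left] at hd ⊢
        intro t ht hts
        rw [Finset.mem_insert] at ht hts
        rcases ht with rfl | ht
        · rcases hts with rfl | hts
          · exact lt_irrefl _ h2
          · exact lt_irrefl _ (hcS _ hts)
        · rcases hts with rfl | hts
          · obtain ⟨_, _, v, hv, hlt⟩ := hT _ ht
            exact lt_asymm hlt (hM v hv)
          · exact hd ht hts
      · intro t ht
        rw [Finset.mem_insert] at ht
        rcases ht with rfl | ht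
        · exact ⟨h3, ⟨_, Finset.mem_insert_of_mem hmm, h1⟩, ⟨M, Finset.mem_insert_self _ _, h2⟩⟩
        · obtain ⟨h0, ⟨u, hu, hu'⟩, ⟨v, hv, hv'⟩⟩ := hT t ht
          exact ⟨h0, ⟨u, Finset.mem_insert_of_mem hu, hu'⟩, ⟨v, Finset.mem_insert_of_mem hv, hv'⟩⟩
    · rw [Finset.not_nonempty_iff_eq_empty] at hS'
      subst hS'
      exact ⟨∅, by simp, by simp, by simp⟩

/-- successive derivatives of eta on the positive axis -/
noncomputable def etaD : ℕ → ℝ → ℝ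
  | 0 => eta
  | 1 => fun t => -Real.log t - 1
  | (k+2) => fun t => (-1)^(k+1) * (k.factorial : ℝ) * (t⁻¹)^(k+1)

theorem etaD_hasDerivAt (k : ℕ) (t : ℝ) (ht : 0 < t) :
    HasDerivAt (etaD k) (etaD (k+1) t) t := by
  match k with
  | 0 =>
    have h := ((hasDerivAt_id t).neg).mul (Real.hasDerivAt_log ht.ne')
    have e : etaD 0 = (-id) * Real.log := by funext s; simp [etaD, eta]
    rw [e]
    refine h.congr_deriv ?_
    simp [etaD]; field_simp; ring
  | 1 =>
    have h := ((Real.hasDerivAt_log ht.ne').neg).sub_const 1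
    refine h.congr_deriv ?_
    simp [etaD]
  | (k+2) =>
    have h := ((hasDerivAt_inv ht.ne').pow (k+1)).const_mul ((-1)^(k+1) * (k.factorial : ℝ))
    refine h.congr_deriv ?_
    simp only [etaD, Nat.factorial_succ]
    push_cast
    rw [← inv_pow]
    ring

theorem eta_cont : Continuous eta := by
  have : eta = Real.negMulLog := by funext s; simp [eta, Real.negMulLog]
  rw [this]; exact Real.continuous_negMulLog

theorem aux_step (p : Polynomial ℝ) (k : ℕ) (t : ℝ) (ht : 0 < t) :
    HasDerivAt (fun s => etaD k s - (Polynomial.derivative^[k] p).eval s)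
      (etaD (k+1) t - (Polynomial.derivative^[k+1] p).eval t) t := by
  refine (etaD_hasDerivAt k t ht).sub ?_
  rw [Function.iterate_succ_apply']
  exact Polynomial.hasDerivAt _ _

/-- Iterated Rolle. -/
theorem aux_iter (p : Polynomial ℝ) (n : ℕ) : ∀ (k : ℕ) (S : Finset ℝ), S.card = n + 1 →
    (∀ s ∈ S, 0 < s) →
    (∀ s ∈ S, etaD k s - (Polynomial.derivative^[k] p).eval s = 0) →
    ∃ s, 0 < s ∧ etaD (k+n) s - (Polynomial.derivative^[k+n] p).eval s = 0 := by
  induction n with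
  | zero =>
    intro k S hc hp hz
    obtain ⟨s, hs⟩ := Finset.card_pos.mp (by omega : 0 < S.card)
    exact ⟨s, hp s hs, hz s hs⟩
  | succ n ih =>
    intro k S hc hp hz
    obtain ⟨T, hTc, _, hT⟩ := aux_rolle
      (fun s => etaD k s - (Polynomial.derivative^[k] p).eval s)
      (fun s => etaD (k+1) s - (Polynomial.derivative^[k+1] p).eval s) S (by
        intro u hu v hv huv
        obtain ⟨c, hc, hc'⟩ := exists_hasDerivAt_eq_zero
          (f := fun s => etaD k s - (Polynomial.derivative^[k] p).eval s)
          (f' := fun s => etaD (k+1) s - (Polynomial.derivative^[k+1] p).eval s) huv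
          (fun s hs => (aux_step p k s ((hp u hu).trans_le hs.1)).continuousAt.continuousWithinAt)
          ((hz u hu).trans (hz v hv).symm)
          (fun s hs => aux_step p k s ((hp u hu).trans hs.1))
        exact ⟨c, hc.1, hc.2, hc'⟩) (Finset.card_pos.mp (by omega))
    obtain ⟨s, hs, hs'⟩ := ih (k+1) T (by omega) (by
      intro t ht
      obtain ⟨_, ⟨u, hu, hu'⟩, _⟩ := hT t ht
      exact (hp u hu).trans hu') (fun t ht => (hT t ht).1)
    refine ⟨s, hs, ?_⟩
    rw [show k + (n+1) = k+1+n by omega]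
    exact hs'

theorem stmt_10 (a b : ℝ) (ha : 0 ≤ a) (hab : a < b) (m : ℕ) (hm : 2 ≤ m)
    (x : ℕ → ℝ) (hx0 : x 0 = a) (hxlast : x (m - 1) = b)
    (hmono : ∀ i, i + 1 ≤ m - 1 → x i < x (i + 1))
    (r : Polynomial ℝ) (hdeg : r.natDegree ≤ 2 * m - 3)
    (hval : ∀ i ≤ m - 1, r.eval (x i) = eta (x i))
    (hder : ∀ i, 0 < i → i < m - 1 →
      (Polynomial.derivative r).eval (x i) = deriv eta (x i)) :
    ∀ y ∈ Set.Icc a b, r.eval y ≤ eta y := by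
  intro y hy
  by_cases hnode : ∃ i ≤ m - 1, y = x i
  · obtain ⟨i, hi, rfl⟩ := hnode
    exact (hval i hi).le
  push Not at hnode
  have hmon : ∀ i j, i < j → j ≤ m - 1 → x i < x j := by
    intro i j hij
    induction j with
    | zero => omega
    | succ j ih =>
      intro hj
      rcases Nat.lt_succ_iff_lt_or_eq.mp hij with h | h
      · exact (ih h (by omega)).trans (hmono j hj)
      · subst h; exact hmono i hj
  have hinj : ∀ i ≤ m - 1, ∀ j ≤ m - 1, x i = x j → i = j := by
    intro i hi j hj h
    rcases lt_trichotomy i j with h' | h' | h'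
    · exact absurd h (hmon i j h' hj).ne
    · exact h'
    · exact absurd h (hmon j i h' hi).ne'
  have hya : a < y := lt_of_le_of_ne hy.1 (fun h => hnode 0 (by omega) (by rw [hx0, h]))
  have hyb : y < b := lt_of_le_of_ne hy.2 (fun h => hnode (m-1) le_rfl (by rw [hxlast, h]))
  let Q : Polynomial ℝ := ∏ i ∈ Finset.Ioo 0 (m-1), (Polynomial.X - Polynomial.C (x i))^2
  let W : Polynomial ℝ := (Polynomial.X - Polynomial.C a) * (Polynomial.X - Polynomial.C b) * Q
  have hQm : Q.Monic := Polynomial.monic_prod_of_monic _ _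
    (fun i _ => (Polynomial.monic_X_sub_C _).pow 2)
  have hWm : W.Monic :=
    ((Polynomial.monic_X_sub_C _).mul (Polynomial.monic_X_sub_C _)).mul hQm
  have hQd : Q.natDegree = 2 * (m - 2) := by
    rw [Polynomial.natDegree_prod_of_monic _ _
      (fun i _ => (Polynomial.monic_X_sub_C _).pow 2)]
    simp [Polynomial.natDegree_pow]
    omega
  have hWd : W.natDegree = 2 * m - 2 := by
    rw [Polynomial.Monic.natDegree_mul
      ((Polynomial.monic_X_sub_C _).mul (Polynomial.monic_X_sub_C _)) hQm,
      Polynomial.Monic.natDegree_mul (Polynomial.monic_X_sub_C _) (Polynomial.monic_X_sub_C _), hQd]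
    simp
    omega
  have hWy : W.eval y < 0 := by
    have h1 : 0 < Q.eval y := by
      simp only [Q, Polynomial.eval_prod]
      refine Finset.prod_pos (fun i hi => ?_)
      rw [Finset.mem_Ioo] at hi
      simp only [Polynomial.eval_pow, Polynomial.eval_sub, Polynomial.eval_X, Polynomial.eval_C]
      have := sub_ne_zero.mpr (hnode i (by omega))
      positivity
    simp only [W, Polynomial.eval_mul, Polynomial.eval_sub, Polynomial.eval_X, Polynomial.eval_C]
    exact mul_neg_of_neg_of_pos (mul_neg_of_pos_of_neg (by linarith) (by linarith)) h1
  have hdvd : ∀ i, 0 < i → i < m - 1 → (Polynomial.X - Polynomial.C (x i))^2 ∣ W := by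
    intro i h0 h1
    exact Dvd.dvd.mul_left (Finset.dvd_prod_of_mem
      (fun i => (Polynomial.X - Polynomial.C (x i))^2) (Finset.mem_Ioo.mpr ⟨h0, h1⟩)) _
  have hWd0 : ∀ i, 0 < i → i < m - 1 → (Polynomial.derivative W).eval (x i) = 0 := by
    intro i h0 h1
    obtain ⟨V, hV⟩ := hdvd i h0 h1
    rw [hV]
    simp [Polynomial.derivative_mul, Polynomial.derivative_pow]
  have hW0 : ∀ i ≤ m - 1, W.eval (x i) = 0 := by
    intro i hi
    rcases Nat.eq_zero_or_pos i with rfl | h0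
    · simp [W, hx0]
    rcases hi.eq_or_lt with rfl | h1
    · simp [W, hxlast]
    obtain ⟨V, hV⟩ := hdvd i h0 h1
    rw [hV]
    simp
  obtain ⟨K, hK⟩ : ∃ K : ℝ, eta y - r.eval y = K * W.eval y :=
    ⟨(eta y - r.eval y) / W.eval y, (div_mul_cancel₀ _ hWy.ne).symm⟩
  suffices hKneg : K < 0 by
    have := mul_pos_of_neg_of_neg hKneg hWy
    linarith
  let p : Polynomial ℝ := r + Polynomial.C K * W
  have hxa : ∀ i ≤ m - 1, a ≤ x i := by
    intro i hi
    rcases Nat.eq_zero_or_pos i with rfl | h0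
    · exact hx0.ge
    · rw [← hx0]; exact (hmon 0 i h0 hi).le
  let N : Finset ℝ := (Finset.range m).image x
  have hNc : N.card = m := by
    rw [Finset.card_image_of_injOn, Finset.card_range]
    intro i hi j hj h
    simp only [Finset.coe_range, Set.mem_Iio] at hi hj
    exact hinj i (by omega) j (by omega) h
  have hyN : y ∉ N := by
    intro h
    obtain ⟨i, hi, h⟩ := Finset.mem_image.mp h
    rw [Finset.mem_range] at hi
    exact hnode i (by omega) h.symm
  have hzero : ∀ s ∈ insert y N, a ≤ s ∧ eta s - p.eval s = 0 := by
    intro s hs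
    rcases Finset.mem_insert.mp hs with rfl | hs
    · refine ⟨hya.le, ?_⟩
      simp only [p, Polynomial.eval_add, Polynomial.eval_mul, Polynomial.eval_C]
      linarith
    · obtain ⟨i, hi, rfl⟩ := Finset.mem_image.mp hs
      rw [Finset.mem_range] at hi
      refine ⟨hxa i (by omega), ?_⟩
      simp only [p, Polynomial.eval_add, Polynomial.eval_mul, Polynomial.eval_C,
        hW0 i (by omega), hval i (by omega)]
      ring
  obtain ⟨T, hTc, hTd, hT⟩ := aux_rolle (fun s => eta s - p.eval s)
    (fun s => etaD 1 s - (Polynomial.derivative^[1] p).eval s) (insert y N) (by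
      intro u hu v hv huv
      obtain ⟨c, hc, hc'⟩ := exists_hasDerivAt_eq_zero
        (f := fun s => eta s - p.eval s)
        (f' := fun s => etaD 1 s - (Polynomial.derivative^[1] p).eval s) huv
        (eta_cont.sub p.continuous).continuousOn
        ((hzero u hu).2.trans (hzero v hv).2.symm)
        (fun s hs => aux_step p 0 s ((ha.trans (hzero u hu).1).trans_lt hs.1))
      exact ⟨c, hc.1, hc.2, hc'⟩) ⟨y, Finset.mem_insert_self _ _⟩
  rw [Finset.card_insert_of_notMem hyN, hNc] at hTc
  let I : Finset ℝ := (Finset.Ioo 0 (m-1)).image x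
  have hIc : I.card = m - 2 := by
    rw [Finset.card_image_of_injOn, Nat.card_Ioo]
    · omega
    intro i hi j hj h
    simp only [Finset.coe_Ioo, Set.mem_Ioo] at hi hj
    exact hinj i (by omega) j (by omega) h
  have hTI : Disjoint T I := by
    refine Finset.disjoint_of_subset_right ?_ hTd
    refine Finset.Subset.trans (Finset.image_subset_image ?_) (Finset.subset_insert _ _)
    intro i hi
    rw [Finset.mem_Ioo] at hi
    rw [Finset.mem_range]; omega
  obtain ⟨s, hs, hs'⟩ := aux_iter p (2*m-3) 1 (T ∪ I)
    (by rw [Finset.card_union_of_disjoint hTI, hIc]; omega)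
    (by
      intro t ht
      rcases Finset.mem_union.mp ht with ht | ht
      · obtain ⟨_, ⟨u, hu, hu'⟩, _⟩ := hT t ht
        exact (ha.trans (hzero u hu).1).trans_lt hu'
      · obtain ⟨i, hi, rfl⟩ := Finset.mem_image.mp ht
        rw [Finset.mem_Ioo] at hi
        have := hmon 0 i hi.1 hi.2.le
        linarith)
    (by
      intro t ht
      rcases Finset.mem_union.mp ht with ht | ht
      · exact (hT t ht).1
      · obtain ⟨i, hi, rfl⟩ := Finset.mem_image.mp ht
        rw [Finset.mem_Ioo] at hi
        have hpos : 0 < x i := by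
          have := hmon 0 i hi.1 hi.2.le
          linarith
        have h1 : deriv eta (x i) = etaD 1 (x i) := (etaD_hasDerivAt 0 (x i) hpos).deriv
        simp only [Function.iterate_one, p, Polynomial.derivative_add, Polynomial.derivative_C_mul,
          Polynomial.eval_add, Polynomial.eval_mul, Polynomial.eval_C, hWd0 i hi.1 hi.2,
          hder i hi.1 hi.2, h1]
        ring)
  obtain ⟨k, rfl⟩ : ∃ k, m = k + 2 := ⟨m - 2, by omega⟩
  rw [show 1 + (2 * (k+2) - 3) = 2*k + 2 by omega] at hs'
  have hpd : p.natDegree ≤ 2*k+2 := by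
    refine (Polynomial.natDegree_add_le _ _).trans (max_le (by omega) ?_)
    refine (Polynomial.natDegree_C_mul_le _ _).trans (by omega)
  have hpc : p.coeff (2*k+2) = K := by
    have h1 : r.coeff (2*k+2) = 0 := Polynomial.coeff_eq_zero_of_natDegree_lt (by omega)
    have h2 : W.coeff (2*k+2) = 1 := by
      have := hWm.coeff_natDegree
      rwa [hWd, show 2 * (k+2) - 2 = 2*k+2 by omega] at this
    simp [p, h1, h2]
  have hev : (Polynomial.derivative^[2*k+2] p).eval s = (2*k+2).factorial * K := by
    have h0 : (Polynomial.derivative^[2*k+2] p).natDegree = 0 := by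
      have := Polynomial.natDegree_iterate_derivative p (2*k+2)
      omega
    rw [Polynomial.eq_C_of_natDegree_eq_zero h0, Polynomial.eval_C,
      Polynomial.coeff_iterate_derivative]
    rw [Nat.zero_add, Nat.descFactorial_self, hpc, nsmul_eq_mul]
  have hneg : etaD (2*k+2) s < 0 := by
    have : ((-1 : ℝ))^(2*k+1) = -1 := by rw [pow_succ, pow_mul]; simp
    simp only [etaD, this]
    have : 0 < ((2*k).factorial : ℝ) * (s⁻¹)^(2*k+1) := by positivity
    linarith
  rw [hev] at hs'
  have hf : (0:ℝ) < (2*k+2).factorial := by positivity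
  by_contra hcon
  have := mul_nonneg hf.le (not_lt.mp hcon)
  linarith
end

section
/- Let 0 ≤ a < b, let m ≥ 2, and let a = x₀ < x₁ < … < x_{m−1} < b. Let r be a real polynomial of degree at most 2m−2 such that r(x_i) = η(x_i) for all 0 ≤ i ≤ m−1 and r′(x_i) = η′(x_i) for all 1 ≤ i ≤ m−1, where η(x) = −x·ln x. Then r(x) ≤ η(x) for all x ∈ [a, b] (Hermite interpolation of η from below, interior case (b) of the appendix lemma). -/
open Polynomial in
theorem aux_rolle_s11 (a : ℝ) (S : Set ℝ) (hS : S.OrdConnected) (hSa : S ⊆ Set.Ici a)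
    (f f' : ℝ → ℝ) (hc : ContinuousOn f S) (hd : ∀ t, a < t → HasDerivAt f (f' t) t)
    (k : ℕ) (Z : Finset ℝ) (hZ : Z.card = k + 1) (hZS : ∀ z ∈ Z, z ∈ S)
    (h0 : ∀ z ∈ Z, f z = 0) :
    ∃ W : Finset ℝ, W.card = k ∧ (∀ w ∈ W, a < w) ∧ Disjoint W Z ∧ ∀ w ∈ W, f' w = 0 := by
  classical
  let e := Z.orderEmbOfFin hZ
  have hm : ∀ i, e i ∈ Z := fun i => Z.orderEmbOfFin_mem hZ i
  have hlt : ∀ i : Fin k, e i.castSucc < e i.succ := fun i =>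
    e.strictMono (Fin.castSucc_lt_succ)
  have hex : ∀ i : Fin k, ∃ c ∈ Set.Ioo (e i.castSucc) (e i.succ), f' c = 0 := by
    intro i
    apply exists_hasDerivAt_eq_zero (hlt i) (f := f)
    · exact hc.mono (hS.out (hZS _ (hm _)) (hZS _ (hm _)))
    · rw [h0 _ (hm _), h0 _ (hm _)]
    · intro t ht
      exact hd t (lt_of_le_of_lt (hSa (hZS _ (hm i.castSucc))) ht.1)
  choose c hc1 hc2 using hex
  have hcm : StrictMono c := by
    intro i j hij
    have h1 : e i.succ ≤ e j.castSucc := e.monotone (by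
      rw [Fin.le_def]; simp; exact hij)
    linarith [(hc1 i).2, (hc1 j).1]
  refine ⟨Finset.univ.image c, ?_, ?_, ?_, ?_⟩
  · rw [Finset.card_image_of_injective _ hcm.injective]; simp
  · intro w hw
    obtain ⟨i, -, rfl⟩ := Finset.mem_image.1 hw
    exact lt_of_le_of_lt (hSa (hZS _ (hm i.castSucc))) (hc1 i).1
  · rw [Finset.disjoint_left]
    intro w hw hwZ
    obtain ⟨i, -, rfl⟩ := Finset.mem_image.1 hw
    have : c i ∈ Set.range e := by
      rw [Finset.range_orderEmbOfFin]; exact hwZ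
    obtain ⟨j, hj⟩ := this
    have h1 := (hc1 i).1
    have h2 := (hc1 i).2
    rw [← hj] at h1 h2
    have h1' := e.lt_iff_lt.1 h1
    have h2' := e.lt_iff_lt.1 h2
    rw [Fin.lt_def] at h1' h2'
    simp at h1' h2'
    omega
  · intro w hw
    obtain ⟨i, -, rfl⟩ := Finset.mem_image.1 hw
    exact hc2 i

theorem aux_iter_s11 (a : ℝ) (k : ℕ) : ∀ (F : ℕ → ℝ → ℝ)
    (_ : ∀ j t, a < t → HasDerivAt (F j) (F (j + 1) t) t)
    (Z : Finset ℝ) (_ : Z.card = k + 1) (_ : ∀ z ∈ Z, a < z) (_ : ∀ z ∈ Z, F 0 z = 0),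
    ∃ t, a < t ∧ F k t = 0 := by
  induction k with
  | zero =>
    intro F hF Z hZ hp h0
    obtain ⟨z, hz⟩ := Finset.card_pos.1 (by omega : 0 < Z.card)
    exact ⟨z, hp z hz, h0 z hz⟩
  | succ k ih =>
    intro F hF Z hZ hp h0
    obtain ⟨W, h1, h2, -, h3⟩ := aux_rolle_s11 a (Set.Ioi a) Set.ordConnected_Ioi
      Set.Ioi_subset_Ici_self (F 0) (F 1)
      (fun t ht => (hF 0 t ht).continuousAt.continuousWithinAt) (hF 0) (k + 1) Z hZ hp h0
    exact ih (fun j => F (j + 1)) (fun j t ht => hF (j + 1) t ht) W h1 h2 h3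

noncomputable def auxE : ℕ → ℝ → ℝ
  | 0, t => -Real.log t - 1
  | k + 1, t => -((-1) ^ k * (Nat.factorial k : ℝ) * (t ^ (k + 1))⁻¹)

theorem auxE_deriv (j : ℕ) (t : ℝ) (ht : 0 < t) : HasDerivAt (auxE j) (auxE (j + 1) t) t := by
  cases j with
  | zero =>
    have := ((Real.hasDerivAt_log ht.ne').neg).sub_const 1
    refine HasDerivAt.congr_deriv (f := _) this ?_
    simp [auxE]
  | succ k =>
    have := ((((hasDerivAt_pow (k + 1) t).inv (by positivity)).const_mul
      ((-1) ^ k * (Nat.factorial k : ℝ)))).neg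
    refine HasDerivAt.congr_deriv (f := _) this ?_
    simp only [auxE, Nat.factorial_succ]
    push_cast
    field_simp
    ring

theorem eta_hasDeriv (t : ℝ) (ht : 0 < t) : HasDerivAt eta (auxE 0 t) t := by
  have := (hasDerivAt_id t).neg.mul (Real.hasDerivAt_log ht.ne')
  refine HasDerivAt.congr_deriv (f := _) this ?_
  simp [auxE]
  field_simp
  ring

open Polynomial in
theorem aux_top (p : ℝ[X]) (d : ℕ) (hp : p.natDegree ≤ d) (t : ℝ) :
    (derivative^[d] p).eval t = (Nat.factorial d : ℝ) * p.coeff d := by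
  have h : (derivative^[d] p).natDegree = 0 := by
    have := natDegree_iterate_derivative p d
    omega
  rw [eq_C_of_natDegree_eq_zero h, eval_C, coeff_iterate_derivative]
  simp [Nat.descFactorial_self]

open Polynomial in
theorem aux_main (a b : ℝ) (ha : 0 ≤ a) (hab : a < b) (m : ℕ) (hm : 2 ≤ m)
    (x : ℕ → ℝ) (hx0 : x 0 = a) (hxlast : x (m - 1) < b)
    (hmono : ∀ i, i + 1 ≤ m - 1 → x i < x (i + 1))
    (r : Polynomial ℝ) (hdeg : r.natDegree ≤ 2 * m - 2)
    (hval : ∀ i ≤ m - 1, r.eval (x i) = _root_.eta (x i))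
    (hder : ∀ i, 1 ≤ i → i ≤ m - 1 →
      (Polynomial.derivative r).eval (x i) = deriv _root_.eta (x i)) :
    ∀ y ∈ Set.Icc a b, r.eval y ≤ _root_.eta y := by
  classical
  intro y hy
  obtain ⟨n, rfl⟩ : ∃ n, m = n + 1 := ⟨m - 1, by omega⟩
  have hn : 1 ≤ n := by omega
  simp only [Nat.add_sub_cancel] at *
  have hlt : ∀ j, j ≤ n → ∀ i, i < j → x i < x j := by
    intro j
    induction j with
    | zero => intro _ i hi; omega
    | succ j ih =>
      intro hj i hi
      rcases Nat.lt_succ_iff_lt_or_eq.1 hi with h | h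
      · exact (ih (by omega) i h).trans (hmono j hj)
      · rw [h]; exact hmono j hj
  have hpos : ∀ i, 1 ≤ i → i ≤ n → a < x i := fun i h1 h2 => hx0 ▸ hlt i h2 0 (by omega)
  have hinj : ∀ i ≤ n, ∀ j ≤ n, x i = x j → i = j := by
    intro i hi j hj h
    rcases lt_trichotomy i j with h' | h' | h'
    · exact absurd h (hlt j hj i h').ne
    · exact h'
    · exact absurd h (hlt i hi j h').ne'
  by_cases hnode : ∃ i ≤ n, x i = y
  · obtain ⟨i, hi, rfl⟩ := hnode
    exact (hval i hi).le
  push Not at hnode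
  have hay : a < y := lt_of_le_of_ne hy.1 (by rw [← hx0]; exact hnode 0 (by omega))
  set q : ℝ[X] := ∏ i ∈ Finset.range n, (X - C (x (i + 1))) with hq
  set w : ℝ[X] := (X - C a) * q ^ 2 with hw
  have hqm : q.Monic := monic_prod_of_monic _ _ (fun i _ => monic_X_sub_C _)
  have hqd : q.natDegree = n := by
    rw [hq, natDegree_prod_of_monic _ _ (fun i _ => monic_X_sub_C _)]; simp
  have hwm : w.Monic := (monic_X_sub_C a).mul (hqm.pow 2)
  have hwd : w.natDegree = 2 * n + 1 := by
    rw [hw, (monic_X_sub_C a).natDegree_mul (hqm.pow 2), hqm.natDegree_pow, hqd,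
      natDegree_X_sub_C]; ring
  have hq0 : ∀ i, 1 ≤ i → i ≤ n → q.eval (x i) = 0 := by
    intro i h1 h2
    rw [hq, eval_prod]
    apply Finset.prod_eq_zero (i := i - 1) (by simp; omega)
    simp [Nat.sub_add_cancel h1]
  have hqy : q.eval y ≠ 0 := by
    rw [hq, eval_prod, Finset.prod_ne_zero_iff]
    intro i hi
    simp only [eval_sub, eval_X, eval_C]
    have := hnode (i + 1) (by simp at hi; omega)
    intro h
    exact this (by linarith)
  have hwy : 0 < w.eval y := by
    simp only [hw, eval_mul, eval_sub, eval_X, eval_C, eval_pow]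
    have : 0 < y - a := by linarith
    positivity
  have hwx : ∀ i ≤ n, w.eval (x i) = 0 := by
    intro i hi
    rcases Nat.eq_zero_or_pos i with rfl | h
    · simp [hw, hx0]
    · simp [hw, hq0 i h hi]
  have hw'x : ∀ i, 1 ≤ i → i ≤ n → (derivative w).eval (x i) = 0 := by
    intro i h1 h2
    simp [hw, derivative_mul, derivative_pow, hq0 i h1 h2]
  set c : ℝ := (_root_.eta y - r.eval y) / w.eval y with hc
  set P : ℝ[X] := r + C c * w with hP
  let F : ℕ → ℝ → ℝ := fun j t => auxE j t - (derivative^[j + 1] P).eval t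
  have hF : ∀ j t, a < t → HasDerivAt (F j) (F (j + 1) t) t := by
    intro j t ht
    have := (auxE_deriv j t (by linarith)).sub ((derivative^[j + 1] P).hasDerivAt t)
    rw [← Function.iterate_succ_apply' (derivative)] at this
    exact this
  have hg : ∀ t, a < t → HasDerivAt (fun t => _root_.eta t - P.eval t) (F 0 t) t := by
    intro t ht
    exact (eta_hasDeriv t (by linarith)).sub (P.hasDerivAt t)
  set N : Finset ℝ := (Finset.range n).image (fun i => x (i + 1)) with hN
  have hNc : N.card = n := by
    rw [hN, Finset.card_image_of_injOn]
    · simp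
    · intro i hi j hj h
      simp at hi hj
      have := hinj (i + 1) (by omega) (j + 1) (by omega) h
      omega
  have hNm : ∀ z ∈ N, ∃ i, 1 ≤ i ∧ i ≤ n ∧ x i = z := by
    intro z hz
    obtain ⟨i, hi, rfl⟩ := Finset.mem_image.1 hz
    simp at hi
    exact ⟨i + 1, by omega, by omega, rfl⟩
  have hyN : y ∉ N := by
    intro h
    obtain ⟨i, _, h2, h3⟩ := hNm y h
    exact hnode i h2 h3
  have haN : a ∉ insert y N := by
    intro h
    rcases Finset.mem_insert.1 h with h | h
    · exact hay.ne h
    · obtain ⟨i, h1, h2, h3⟩ := hNm a h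
      exact (hpos i h1 h2).ne' h3
  set Z : Finset ℝ := insert a (insert y N) with hZ
  have hZc : Z.card = (n + 1) + 1 := by
    rw [hZ, Finset.card_insert_of_notMem haN, Finset.card_insert_of_notMem hyN, hNc]
  have hgx : ∀ i ≤ n, _root_.eta (x i) - P.eval (x i) = 0 := by
    intro i hi
    simp [hP, hwx i hi, hval i hi]
  have hZ0 : ∀ z ∈ Z, a ≤ z ∧ _root_.eta z - P.eval z = 0 := by
    intro z hz
    rcases Finset.mem_insert.1 hz with h | h
    · rw [h]
      exact ⟨le_rfl, by have := hgx 0 (by omega); rwa [hx0] at this⟩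
    rcases Finset.mem_insert.1 h with h | h
    · rw [h]
      refine ⟨hay.le, ?_⟩
      simp only [hP, eval_add, eval_mul, eval_C, hc]
      field_simp
      ring
    · obtain ⟨i, h1, h2, rfl⟩ := hNm z h
      exact ⟨(hpos i h1 h2).le, hgx i h2⟩
  obtain ⟨W, hW1, hW2, hW3, hW4⟩ := aux_rolle_s11 a (Set.Ici a) Set.ordConnected_Ici le_rfl
    (fun t => _root_.eta t - P.eval t) (F 0) (eta_cont.sub P.continuous).continuousOn hg (n + 1) Z hZc
    (fun z hz => (hZ0 z hz).1) (fun z hz => (hZ0 z hz).2)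
  have hdisj : Disjoint W N := hW3.mono_right (by
    intro z hz; simp [hZ, hz])
  have hUc : (W ∪ N).card = 2 * n + 1 := by
    rw [Finset.card_union_of_disjoint hdisj, hW1, hNc]; ring
  obtain ⟨t, hat, ht⟩ := aux_iter_s11 a (2 * n) F hF (W ∪ N) hUc (by
      intro z hz
      rcases Finset.mem_union.1 hz with h | h
      · exact hW2 z h
      · obtain ⟨i, h1, h2, rfl⟩ := hNm z h
        exact hpos i h1 h2) (by
      intro z hz
      rcases Finset.mem_union.1 hz with h | h
      · exact hW4 z h
      · obtain ⟨i, h1, h2, rfl⟩ := hNm z h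
        have h3 := hder i h1 h2
        rw [(eta_hasDeriv (x i) (by linarith [hpos i h1 h2])).deriv] at h3
        simp [F, hP, hw'x i h1 h2, h3])
  have ht0 : 0 < t := by linarith
  have hcoef : P.coeff (2 * n + 1) = c := by
    have h1 : r.coeff (2 * n + 1) = 0 := coeff_eq_zero_of_natDegree_lt (by omega)
    have h2 : w.coeff (2 * n + 1) = 1 := by rw [← hwd]; exact hwm
    simp [hP, h1, h2]
  have hPd : P.natDegree ≤ 2 * n + 1 := by
    rw [hP]
    apply natDegree_add_le_of_degree_le (by omega)
    exact (natDegree_C_mul_le _ _).trans hwd.le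
  have hE : 0 < auxE (2 * n) t := by
    obtain ⟨k, rfl⟩ : ∃ k, n = k + 1 := ⟨n - 1, by omega⟩
    have : 2 * (k + 1) = (2 * k + 1) + 1 := by ring
    rw [this]
    simp only [auxE]
    rw [Odd.neg_one_pow ⟨k, rfl⟩]
    simp only [neg_mul, one_mul, neg_neg]
    positivity
  have hcpos : 0 < c := by
    simp only [F] at ht
    rw [aux_top P _ hPd, hcoef] at ht
    have h1 : 0 < (Nat.factorial (2 * n + 1) : ℝ) * c := by linarith
    exact pos_of_mul_pos_right h1 (by positivity)
  have hfin : c * w.eval y = _root_.eta y - r.eval y := by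
    rw [hc]; field_simp
  have := mul_pos hcpos hwy
  linarith

theorem stmt_11 (a b : ℝ) (ha : 0 ≤ a) (hab : a < b) (m : ℕ) (hm : 2 ≤ m)
    (x : ℕ → ℝ) (hx0 : x 0 = a) (hxlast : x (m - 1) < b)
    (hmono : ∀ i, i + 1 ≤ m - 1 → x i < x (i + 1))
    (r : Polynomial ℝ) (hdeg : r.natDegree ≤ 2 * m - 2)
    (hval : ∀ i ≤ m - 1, r.eval (x i) = eta (x i))
    (hder : ∀ i, 1 ≤ i → i ≤ m - 1 →
      (Polynomial.derivative r).eval (x i) = deriv eta (x i)) :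
    ∀ y ∈ Set.Icc a b, r.eval y ≤ eta y := by
  exact aux_main a b ha hab m hm x hx0 hxlast hmono r hdeg hval hder
end

section
/- Let d ≥ 1 and let μ be the Haar probability measure on the unitary group U(d) of d×d complex matrices. Then for every d×d complex matrix A, ∫ U·A·U* dμ(U) = (Tr[A]/d)·I, where I is the d×d identity matrix. -/
open MeasureTheory
open scoped BigOperators Matrix

/-- The Haar average identity: for the Haar probability measure `μ` on the unitary group
`U(d)` and any `d×d` complex matrix `A`, `∫ U·A·U* dμ(U) = (Tr[A]/d)·I`
(stated entrywise). -/
theorem stmt_13 (d : ℕ) (hd : 1 ≤ d)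
    [MeasurableSpace (Matrix.unitaryGroup (Fin d) ℂ)]
    [BorelSpace (Matrix.unitaryGroup (Fin d) ℂ)]
    (μ : Measure (Matrix.unitaryGroup (Fin d) ℂ))
    [μ.IsHaarMeasure] [IsProbabilityMeasure μ]
    (A : Matrix (Fin d) (Fin d) ℂ) :
    ∀ i j, (∫ U, ((U : Matrix (Fin d) (Fin d) ℂ) * A *
        star (U : Matrix (Fin d) (Fin d) ℂ)) i j ∂μ)
      = ((A.trace / (d : ℂ)) • (1 : Matrix (Fin d) (Fin d) ℂ)) i j := by
  set f : Matrix.unitaryGroup (Fin d) ℂ → Matrix (Fin d) (Fin d) ℂ := fun U =>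
    (U : Matrix (Fin d) (Fin d) ℂ) * A * star (U : Matrix (Fin d) (Fin d) ℂ) with hf
  have hmul : ∀ V U : Matrix.unitaryGroup (Fin d) ℂ, f (V * U) =
      (V : Matrix (Fin d) (Fin d) ℂ) * f U * star (V : Matrix (Fin d) (Fin d) ℂ) := by
    intro V U
    simp only [hf, Submonoid.coe_mul, star_mul, mul_assoc]
  have hinv : ∀ (V : Matrix.unitaryGroup (Fin d) ℂ) i j,
      ∫ U, f (V * U) i j ∂μ = ∫ U, f U i j ∂μ := fun V i j =>
    integral_mul_left_eq_self (fun U => f U i j) V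
  have hcont : ∀ i j, Continuous fun U => f U i j := by
    intro i j
    have : Continuous f := by
      simp only [hf]
      fun_prop
    exact this.matrix_elem i j
  have hint : ∀ i j, Integrable (fun U => f U i j) μ := by
    intro i j
    refine Integrable.of_bound (hcont i j).aestronglyMeasurable
      (∑ k, ∑ l, ‖A l k‖) (Filter.Eventually.of_forall fun U => ?_)
    simp only [hf, Matrix.mul_apply, Finset.sum_mul]
    refine (norm_sum_le _ _).trans (Finset.sum_le_sum fun k _ => ?_)
    refine (norm_sum_le _ _).trans (Finset.sum_le_sum fun l _ => ?_)
    rw [norm_mul, norm_mul, Matrix.star_apply, norm_star]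
    have h1 := entry_norm_bound_of_unitary U.2 i l
    have h2 := entry_norm_bound_of_unitary U.2 j k
    calc _ ≤ 1 * ‖A l k‖ * 1 := by gcongr
      _ = _ := by ring
  have hoff : ∀ i j, i ≠ j → ∫ U, f U i j ∂μ = 0 := by
    intro i j hij
    let v : Fin d → ℂ := fun k => if k = i then -1 else 1
    have hV : Matrix.diagonal v ∈ Matrix.unitaryGroup (Fin d) ℂ := by
      rw [Matrix.mem_unitaryGroup_iff, Matrix.star_eq_conjTranspose,
        Matrix.diagonal_conjTranspose, Matrix.diagonal_mul_diagonal, ← Matrix.diagonal_one]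
      congr 1
      funext k
      by_cases hk : k = i <;> simp [v, hk]
    have h := hinv ⟨_, hV⟩ i j
    have e : ∀ U, f (⟨_, hV⟩ * U) i j = - f U i j := by
      intro U
      rw [hmul]
      simp [Matrix.star_eq_conjTranspose, Matrix.diagonal_conjTranspose, v, hij.symm]
    simp only [e, integral_neg] at h
    exact self_eq_neg.mp h.symm
  have hdiag : ∀ i j, ∫ U, f U i i ∂μ = ∫ U, f U j j ∂μ := by
    intro i j
    let P : Matrix (Fin d) (Fin d) ℂ := (1 : Matrix (Fin d) (Fin d) ℂ).submatrix (Equiv.swap i j) id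
    have hP : ∀ X : Matrix (Fin d) (Fin d) ℂ,
        P * X * star P = X.submatrix (Equiv.swap i j) (Equiv.swap i j) := by
      intro X
      ext a b
      simp [P, Matrix.mul_apply, Matrix.one_apply, Matrix.star_apply]
    have hV : P ∈ Matrix.unitaryGroup (Fin d) ℂ := by
      rw [Matrix.mem_unitaryGroup_iff]
      have := hP 1
      rwa [mul_one, Matrix.submatrix_one_equiv] at this
    rw [← hinv ⟨P, hV⟩ i i]
    simp [hmul, hP]
  have htr : ∑ i, ∫ U, f U i i ∂μ = A.trace := by
    rw [← integral_finsetSum _ fun i _ => hint i i]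
    have : ∀ U, ∑ i, f U i i = A.trace := by
      intro U
      change (f U).trace = _
      simp only [hf]
      rw [Matrix.trace_mul_comm, ← mul_assoc, Matrix.mem_unitaryGroup_iff'.mp U.2, one_mul]
    simp [this]
  intro i j
  change ∫ U, f U i j ∂μ = _
  have hd0 : (d : ℂ) ≠ 0 := by exact_mod_cast (by omega : d ≠ 0)
  by_cases hij : i = j
  · subst hij
    rw [Finset.sum_congr rfl fun k _ => hdiag k i] at htr
    simp at htr
    simp [← htr]
    field_simp
  · simp [hoff i j hij, hij]
end

section
/- Let (p_x, χ̂_x)_{x∈A} be a finite mixed t-design in dimension d with reference density matrix χ̂. Then for every integer k with 1 ≤ k ≤ t, the k-th moment of the design equals the k-th moment of the reference operator: Σ_x p_x·Tr[χ̂_x^k] = Tr[χ̂^k]. -/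
open MeasureTheory
open scoped BigOperators Matrix ComplexOrder

/-- The `t`-fold Kronecker (tensor) power of a `d×d` matrix, indexed by `Fin t → Fin d`. -/
noncomputable def tpow {d : ℕ} (t : ℕ) (M : Matrix (Fin d) (Fin d) ℂ) :
    Matrix (Fin t → Fin d) (Fin t → Fin d) ℂ :=
  fun i j => ∏ k, M (i k) (j k)

/-- `(p, χ)` is a finite mixed `t`-design in dimension `d` with reference operator `χref`
(with respect to the measure `μ` on `U(d)`): `Σ_x p_x·χ_x^{⊗t} = ∫ (U·χref·U*)^{⊗t} dμ(U)`
(stated entrywise). -/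
def IsMixedDesign (d : ℕ) {A : Type} [Fintype A]
    [MeasurableSpace (Matrix.unitaryGroup (Fin d) ℂ)]
    (μ : Measure (Matrix.unitaryGroup (Fin d) ℂ))
    (p : A → ℝ) (χ : A → Matrix (Fin d) (Fin d) ℂ)
    (χref : Matrix (Fin d) (Fin d) ℂ) (t : ℕ) : Prop :=
  ∀ i j, ∑ x, (p x : ℂ) * tpow t (χ x) i j
    = ∫ U, tpow t ((U : Matrix (Fin d) (Fin d) ℂ) * χref *
        star (U : Matrix (Fin d) (Fin d) ℂ)) i j ∂μ

/-- Span of the entry functions of the `t`-th tensor power. -/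
noncomputable def goodSpan (d t : ℕ) : Submodule ℂ (Matrix (Fin d) (Fin d) ℂ → ℂ) :=
  Submodule.span ℂ (Set.range fun q : (Fin t → Fin d) × (Fin t → Fin d) =>
    fun M => tpow t M q.1 q.2)

lemma good_mul_entry {d t : ℕ} {f : Matrix (Fin d) (Fin d) ℂ → ℂ} (hf : f ∈ goodSpan d t)
    (a b : Fin d) : (fun M => f M * M a b) ∈ goodSpan d (t + 1) := by
  unfold goodSpan at hf
  induction hf using Submodule.span_induction with
  | mem x hx =>
    obtain ⟨q, rfl⟩ := hx
    apply Submodule.subset_span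
    refine ⟨(Fin.snoc q.1 a, Fin.snoc q.2 b), ?_⟩
    funext M
    simp [tpow, Fin.prod_univ_castSucc]
  | zero =>
    convert (goodSpan d (t + 1)).zero_mem using 1
    funext M
    simp
  | add x y _ _ hx hy =>
    convert (goodSpan d (t + 1)).add_mem hx hy using 1
    funext M
    simp [add_mul]
  | smul c x _ hx =>
    convert (goodSpan d (t + 1)).smul_mem c hx using 1
    funext M
    simp [mul_assoc]

lemma good_sum {d t : ℕ} {ι : Type} (s : Finset ι) (f : ι → Matrix (Fin d) (Fin d) ℂ → ℂ)
    (hf : ∀ i, f i ∈ goodSpan d t) : (fun M => ∑ i ∈ s, f i M) ∈ goodSpan d t := by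
  convert (goodSpan d t).sum_mem (t := s) (fun i _ => hf i) using 1
  funext M
  simp

lemma good_pow {d : ℕ} (k : ℕ) (a b : Fin d) :
    (fun M : Matrix (Fin d) (Fin d) ℂ => (M ^ k) a b) ∈ goodSpan d k := by
  induction k generalizing b with
  | zero =>
    have h1 : (fun _ => 1 : Matrix (Fin d) (Fin d) ℂ → ℂ) ∈ goodSpan d 0 := by
      apply Submodule.subset_span
      refine ⟨(Fin.elim0, Fin.elim0), ?_⟩
      funext M
      simp [tpow]
    convert (goodSpan d 0).smul_mem ((1 : Matrix (Fin d) (Fin d) ℂ) a b) h1 using 1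
    funext M
    simp
  | succ k ih =>
    simp only [pow_succ, Matrix.mul_apply]
    exact good_sum _ _ fun c => good_mul_entry (ih c) c b

lemma good_trace {d : ℕ} (k m : ℕ) :
    (fun M : Matrix (Fin d) (Fin d) ℂ => (M ^ k).trace * M.trace ^ m) ∈ goodSpan d (k + m) := by
  induction m with
  | zero =>
    simp only [pow_zero, mul_one, Matrix.trace, Matrix.diag]
    exact good_sum _ _ fun c => good_pow k c c
  | succ m ih =>
    rw [← add_assoc]
    have := good_sum Finset.univ _ fun c : Fin d => good_mul_entry ih c c
    convert this using 1
    funext M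
    rw [← Finset.mul_sum, pow_succ, ← mul_assoc]
    rfl

lemma tpow_integrable (d : ℕ)
    [MeasurableSpace (Matrix.unitaryGroup (Fin d) ℂ)]
    [BorelSpace (Matrix.unitaryGroup (Fin d) ℂ)]
    (μ : Measure (Matrix.unitaryGroup (Fin d) ℂ)) [IsProbabilityMeasure μ]
    (C : Matrix (Fin d) (Fin d) ℂ) (t : ℕ) (i j : Fin t → Fin d) :
    Integrable (fun U : Matrix.unitaryGroup (Fin d) ℂ =>
      tpow t ((U : Matrix (Fin d) (Fin d) ℂ) * C * star (U : Matrix (Fin d) (Fin d) ℂ)) i j) μ := by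
  have hc : Continuous (fun U : Matrix.unitaryGroup (Fin d) ℂ =>
      tpow t ((U : Matrix (Fin d) (Fin d) ℂ) * C * star (U : Matrix (Fin d) (Fin d) ℂ)) i j) := by
    unfold tpow
    refine continuous_finsetProd _ fun k _ => ?_
    have : Continuous (fun U : Matrix.unitaryGroup (Fin d) ℂ =>
      ((U : Matrix (Fin d) (Fin d) ℂ) * C * star (U : Matrix (Fin d) (Fin d) ℂ))) :=
      (continuous_subtype_val.mul continuous_const).mul continuous_subtype_val.star
    exact this.matrix_elem _ _
  refine Integrable.of_bound
    (C := ∏ _k : Fin t, ∑ b : Fin d, ∑ a : Fin d, ‖C a b‖) ?_ (Filter.Eventually.of_forall fun U => ?_)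
  · exact hc.measurable.aestronglyMeasurable
  · unfold tpow
    rw [norm_prod]
    refine Finset.prod_le_prod (fun _ _ => norm_nonneg _) fun k _ => ?_
    rw [Matrix.mul_apply]
    refine (norm_sum_le _ _).trans (Finset.sum_le_sum fun b _ => ?_)
    rw [norm_mul, Matrix.star_apply, norm_star]
    have hU := fun a b => entry_norm_bound_of_unitary U.2 a b
    refine (mul_le_of_le_one_right (norm_nonneg _) (hU _ _)).trans ?_
    rw [Matrix.mul_apply]
    refine (norm_sum_le _ _).trans (Finset.sum_le_sum fun a _ => ?_)
    rw [norm_mul]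
    exact mul_le_of_le_one_left (norm_nonneg _) (hU _ _)

/-- Eq. (2): the moments of a finite mixed `t`-design equal the moments of its reference
operator, `Σ_x p_x·Tr[χ̂_x^k] = Tr[χ̂^k]` for every `1 ≤ k ≤ t`. -/
theorem stmt_15 (d : ℕ) (hd : 1 ≤ d) {A : Type} [Fintype A]
    [MeasurableSpace (Matrix.unitaryGroup (Fin d) ℂ)]
    [BorelSpace (Matrix.unitaryGroup (Fin d) ℂ)]
    (μ : Measure (Matrix.unitaryGroup (Fin d) ℂ))
    [μ.IsHaarMeasure] [IsProbabilityMeasure μ]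
    (p : A → ℝ) (hp0 : ∀ x, 0 ≤ p x) (hp1 : ∑ x, p x = 1)
    (χ : A → Matrix (Fin d) (Fin d) ℂ)
    (hχ : ∀ x, (χ x).PosSemidef ∧ (χ x).trace = 1)
    (χref : Matrix (Fin d) (Fin d) ℂ)
    (href : χref.PosSemidef ∧ χref.trace = 1)
    (t : ℕ) (ht : 1 ≤ t)
    (hdesign : IsMixedDesign d μ p χ χref t) :
    ∀ k, 1 ≤ k → k ≤ t →
      ∑ x, (p x : ℂ) * ((χ x) ^ k).trace = (χref ^ k).trace := by
  intro k _ hk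
  obtain ⟨m, rfl⟩ := Nat.exists_eq_add_of_le hk
  have key : ∀ f ∈ goodSpan d (k + m),
      Integrable (fun U : Matrix.unitaryGroup (Fin d) ℂ =>
        f ((U : Matrix (Fin d) (Fin d) ℂ) * χref * star (U : Matrix (Fin d) (Fin d) ℂ))) μ ∧
      ∑ x, (p x : ℂ) * f (χ x) = ∫ U : Matrix.unitaryGroup (Fin d) ℂ,
        f ((U : Matrix (Fin d) (Fin d) ℂ) * χref * star (U : Matrix (Fin d) (Fin d) ℂ)) ∂μ := by
    intro f hf
    unfold goodSpan at hf
    induction hf using Submodule.span_induction with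
    | mem x hx =>
      obtain ⟨q, rfl⟩ := hx
      exact ⟨tpow_integrable d μ χref _ _ _, hdesign q.1 q.2⟩
    | zero => simp
    | add x y _ _ hx hy =>
      refine ⟨hx.1.add hy.1, ?_⟩
      simp only [Pi.add_apply, mul_add, Finset.sum_add_distrib]
      rw [integral_add hx.1 hy.1, hx.2, hy.2]
    | smul c x _ hx =>
      refine ⟨hx.1.smul c, ?_⟩
      simp only [Pi.smul_apply, smul_eq_mul]
      rw [integral_const_mul, ← hx.2, Finset.mul_sum]
      exact Finset.sum_congr rfl fun _ _ => by ring
  have h := (key _ (good_trace k m)).2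
  simp only [(hχ _).2, one_pow, mul_one] at h
  rw [h]
  have hconj : ∀ (U : Matrix.unitaryGroup (Fin d) ℂ) (n : ℕ),
      (((U : Matrix (Fin d) (Fin d) ℂ) * χref * star (U : Matrix (Fin d) (Fin d) ℂ)) ^ n).trace
        = (χref ^ n).trace := by
    intro U n
    have h1 : star (U : Matrix (Fin d) (Fin d) ℂ) * (U : Matrix (Fin d) (Fin d) ℂ) = 1 :=
      (Unitary.mem_iff.mp U.2).1
    have h2 : (U : Matrix (Fin d) (Fin d) ℂ) * star (U : Matrix (Fin d) (Fin d) ℂ) = 1 :=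
      (Unitary.mem_iff.mp U.2).2
    have h3 : ((U : Matrix (Fin d) (Fin d) ℂ) * χref * star (U : Matrix (Fin d) (Fin d) ℂ)) ^ n
        = (U : Matrix (Fin d) (Fin d) ℂ) * χref ^ n * star (U : Matrix (Fin d) (Fin d) ℂ) := by
      induction n with
      | zero => simp [h2]
      | succ n ih =>
        rw [pow_succ, ih, pow_succ]
        simp only [mul_assoc]
        rw [← mul_assoc (star (U : Matrix (Fin d) (Fin d) ℂ)) (U : Matrix (Fin d) (Fin d) ℂ), h1,
          one_mul]
    rw [h3, Matrix.trace_mul_comm, ← mul_assoc, h1, one_mul]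
  have htr := fun U => hconj U 1
  simp only [pow_one] at htr
  simp [hconj, htr, href.2]
end

section
/- Let (p_x, χ̂_x)_{x∈A} be a finite mixed t-design in dimension d with reference density matrix χ̂, and let λ ∈ [0, 1]. Define the depolarized family D_λ(χ̂_x) := λ·χ̂_x + (1−λ)·I/d. Then (p_x, D_λ(χ̂_x))_{x∈A} is again a finite mixed t-design, with reference operator D_λ(χ̂) = λ·χ̂ + (1−λ)·I/d; that is, Σ_x p_x·(λ·χ̂_x + (1−λ)·I/d)^{⊗t} = ∫ (U·(λ·χ̂ + (1−λ)·I/d)·U*)^{⊗t} dU. -/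
open MeasureTheory
open scoped BigOperators Matrix ComplexOrder

/-- The depolarizing map `D_λ(ρ) = λ·ρ + (1−λ)·I/d` on `d×d` matrices. -/
noncomputable def depolarize (d : ℕ) (lam : ℝ) (ρ : Matrix (Fin d) (Fin d) ℂ) :
    Matrix (Fin d) (Fin d) ℂ :=
  (lam : ℂ) • ρ + (((1 - lam : ℝ) : ℂ) / (d : ℂ)) • (1 : Matrix (Fin d) (Fin d) ℂ)

/-- Coefficients of the linear extension of the depolarizing map. -/
noncomputable def depCoeff (d : ℕ) (lam : ℝ) (i j : Fin d) (q : Fin d × Fin d) : ℂ :=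
  (if q = (i, j) then (lam : ℂ) else 0) +
    (if q.1 = q.2 then (((1 - lam : ℝ) : ℂ) / (d : ℂ)) * (1 : Matrix (Fin d) (Fin d) ℂ) i j else 0)

lemma depolarize_apply_eq (d : ℕ) (lam : ℝ) (M : Matrix (Fin d) (Fin d) ℂ) (hM : M.trace = 1)
    (i j : Fin d) : depolarize d lam M i j = ∑ q, depCoeff d lam i j q * M q.1 q.2 := by
  have h2 : ∑ q : Fin d × Fin d, (if q.1 = q.2 then
      (((1 - lam : ℝ) : ℂ) / (d : ℂ)) * (1 : Matrix (Fin d) (Fin d) ℂ) i j else 0) * M q.1 q.2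
      = (((1 - lam : ℝ) : ℂ) / (d : ℂ)) * (1 : Matrix (Fin d) (Fin d) ℂ) i j * M.trace := by
    rw [Fintype.sum_prod_type]
    simp only [ite_mul, zero_mul, Finset.sum_ite_eq, Finset.mem_univ, if_true, Matrix.trace,
      Matrix.diag, Finset.mul_sum]
  simp only [depCoeff, add_mul, Finset.sum_add_distrib]
  rw [h2, hM]
  simp [depolarize]

lemma tpow_depolarize (d t : ℕ) (lam : ℝ) (M : Matrix (Fin d) (Fin d) ℂ) (hM : M.trace = 1)
    (i j : Fin t → Fin d) :
    tpow t (depolarize d lam M) i j = ∑ f : Fin t → Fin d × Fin d,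
      (∏ k, depCoeff d lam (i k) (j k) (f k)) *
        tpow t M (fun k => (f k).1) (fun k => (f k).2) := by
  simp only [tpow, depolarize_apply_eq d lam M hM, Finset.prod_univ_sum, Finset.prod_mul_distrib,
    Fintype.piFinset_univ]

lemma conj_depolarize (d : ℕ) (lam : ℝ) (M : Matrix (Fin d) (Fin d) ℂ)
    (U : Matrix.unitaryGroup (Fin d) ℂ) :
    (U : Matrix (Fin d) (Fin d) ℂ) * depolarize d lam M * star (U : Matrix (Fin d) (Fin d) ℂ)
      = depolarize d lam ((U : Matrix (Fin d) (Fin d) ℂ) * M *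
        star (U : Matrix (Fin d) (Fin d) ℂ)) := by
  have h : (U : Matrix (Fin d) (Fin d) ℂ) * star (U : Matrix (Fin d) (Fin d) ℂ) = 1 :=
    Unitary.mul_star_self_of_mem U.2
  simp [depolarize, mul_add, add_mul, h]

lemma trace_conj (d : ℕ) (M : Matrix (Fin d) (Fin d) ℂ)
    (U : Matrix.unitaryGroup (Fin d) ℂ) :
    ((U : Matrix (Fin d) (Fin d) ℂ) * M * star (U : Matrix (Fin d) (Fin d) ℂ)).trace
      = M.trace := by
  have h : star (U : Matrix (Fin d) (Fin d) ℂ) * (U : Matrix (Fin d) (Fin d) ℂ) = 1 :=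
    Unitary.star_mul_self_of_mem U.2
  rw [Matrix.trace_mul_comm, ← mul_assoc, h, one_mul]

lemma integrable_tpow (d t : ℕ)
    [MeasurableSpace (Matrix.unitaryGroup (Fin d) ℂ)]
    [BorelSpace (Matrix.unitaryGroup (Fin d) ℂ)]
    (μ : Measure (Matrix.unitaryGroup (Fin d) ℂ)) [IsProbabilityMeasure μ]
    (M : Matrix (Fin d) (Fin d) ℂ) (a b : Fin t → Fin d) :
    Integrable (fun U : Matrix.unitaryGroup (Fin d) ℂ =>
      tpow t ((U : Matrix (Fin d) (Fin d) ℂ) * M *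
        star (U : Matrix (Fin d) (Fin d) ℂ)) a b) μ := by
  have hc : Continuous (fun U : Matrix.unitaryGroup (Fin d) ℂ =>
      tpow t ((U : Matrix (Fin d) (Fin d) ℂ) * M *
        star (U : Matrix (Fin d) (Fin d) ℂ)) a b) := by
    have h1 : Continuous (fun U : Matrix.unitaryGroup (Fin d) ℂ =>
      ((U : Matrix (Fin d) (Fin d) ℂ) * M * star (U : Matrix (Fin d) (Fin d) ℂ))) :=
      (continuous_subtype_val.mul continuous_const).mul continuous_subtype_val.star
    unfold tpow
    exact continuous_finset_prod _ fun k _ => h1.matrix_elem _ _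
  refine Integrable.of_bound hc.aestronglyMeasurable
    (∏ k : Fin t, ∑ _q : Fin d, ∑ r : Fin d, ‖M r _q‖) (Filter.Eventually.of_forall fun U => ?_)
  unfold tpow
  rw [norm_prod]
  refine Finset.prod_le_prod (fun _ _ => norm_nonneg _) fun k _ => ?_
  rw [Matrix.mul_apply]
  refine (norm_sum_le _ _).trans (Finset.sum_le_sum fun q _ => ?_)
  rw [norm_mul, Matrix.mul_apply]
  have hs : ‖(star (U : Matrix (Fin d) (Fin d) ℂ)) q (b k)‖ ≤ 1 := by
    rw [Matrix.star_apply, norm_star]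
    exact entry_norm_bound_of_unitary U.2 _ _
  refine (mul_le_of_le_one_right (norm_nonneg _) hs).trans ?_
  refine (norm_sum_le _ _).trans (Finset.sum_le_sum fun r _ => ?_)
  rw [norm_mul]
  exact mul_le_of_le_one_left (norm_nonneg _) (entry_norm_bound_of_unitary U.2 _ _)

/-- The depolarized version of a finite mixed `t`-design is again a finite mixed
`t`-design, with reference operator `D_λ(χ̂)`. -/
theorem stmt_18 (d : ℕ) (hd : 1 ≤ d) {A : Type} [Fintype A]
    [MeasurableSpace (Matrix.unitaryGroup (Fin d) ℂ)]
    [BorelSpace (Matrix.unitaryGroup (Fin d) ℂ)]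
    (μ : Measure (Matrix.unitaryGroup (Fin d) ℂ))
    [μ.IsHaarMeasure] [IsProbabilityMeasure μ]
    (p : A → ℝ) (hp0 : ∀ x, 0 ≤ p x) (hp1 : ∑ x, p x = 1)
    (χ : A → Matrix (Fin d) (Fin d) ℂ)
    (hχ : ∀ x, (χ x).PosSemidef ∧ (χ x).trace = 1)
    (χref : Matrix (Fin d) (Fin d) ℂ)
    (href : χref.PosSemidef ∧ χref.trace = 1)
    (t : ℕ) (ht : 1 ≤ t)
    (lam : ℝ) (hlam : lam ∈ Set.Icc (0 : ℝ) 1)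
    (hdesign : IsMixedDesign d μ p χ χref t) :
    IsMixedDesign d μ p (fun x => depolarize d lam (χ x)) (depolarize d lam χref) t := by
  intro i j
  simp only [conj_depolarize]
  have e1 : ∀ x, tpow t (depolarize d lam (χ x)) i j = _ :=
    fun x => tpow_depolarize d t lam (χ x) (hχ x).2 i j
  have e2 : ∀ U : Matrix.unitaryGroup (Fin d) ℂ, tpow t (depolarize d lam
      ((U : Matrix (Fin d) (Fin d) ℂ) * χref * star (U : Matrix (Fin d) (Fin d) ℂ))) i j = _ :=
    fun U => tpow_depolarize d t lam _ ((trace_conj d χref U).trans href.2) i j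
  simp only [e1, e2]
  rw [integral_finset_sum _ fun f _ => (integrable_tpow d t μ χref _ _).const_mul _]
  simp only [Finset.mul_sum]
  rw [Finset.sum_comm]
  refine Finset.sum_congr rfl fun f _ => ?_
  rw [integral_const_mul, ← hdesign, Finset.mul_sum]
  exact Finset.sum_congr rfl fun x _ => mul_left_comm _ _ _
end
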